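/- Let s be an integer with 7q^5 - 14q^3 + 7q^2 + 12 ≤ s and 2s ≤ q^7 - q^6 + q^5 + q^4 - 2q^3 + q^2 - 2, and set N = q^8 - q^6 + q^5 and d = s - q^5 + 2q^3 - q^2 + 2. Then q^{6(2s - q^5 + 2q^3 - q^2 + 4)} - 1 ≤ (q^{12} - 1) · ∑_{i=1}^{d-1} (q^{12} - 1)^{i-1} · binom(N, i); that is, the quantum Gilbert–Varshamov condition (q_0^{N-k+2} - 1)/(q_0^2 - 1) > ∑_{i=1}^{d-1} (q_0^2 - 1)^{i-1} binom(N, i) fails for alphabet size q_0 = q^6 and k = N + q^5 - 2q^3 + q^2 - 2 - 2s. -/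

import Mathlib

theorem aux_choose (c : ℕ) (hc : 1 ≤ c) : ∀ (m N : ℕ), c * m ≤ N → c ^ m ≤ N.choose m := by
  intro m
  induction m with
  | zero => intro N _; simp
  | succ m ih =>
    intro N h
    obtain ⟨n, rfl⟩ : ∃ n, N = n + 1 := ⟨N - 1, by
      have : 1 * 1 ≤ c * (m + 1) := Nat.mul_le_mul hc (by omega)
      omega⟩
    have h1 := ih n (by rw [mul_add] at h; omega)
    have h2 := Nat.add_one_mul_choose_eq n m
    have h3 : c ^ (m + 1) * (m + 1) ≤ (n + 1).choose (m + 1) * (m + 1) := by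
      rw [← h2]
      calc c ^ (m + 1) * (m + 1) = (c * (m + 1)) * c ^ m := by ring
        _ ≤ (n + 1) * n.choose m := Nat.mul_le_mul h h1
    exact Nat.le_of_mul_le_mul_right h3 (by omega)

/-- Let `q ≥ 2` be an integer and `s` an integer with
`7q^5 - 14q^3 + 7q^2 + 12 ≤ s` and `2s ≤ q^7 - q^6 + q^5 + q^4 - 2q^3 + q^2 - 2`.
Set `N = q^8 - q^6 + q^5` and `d = s - q^5 + 2q^3 - q^2 + 2`. Then
`q^{6(2s - q^5 + 2q^3 - q^2 + 4)} - 1 ≤ (q^{12}-1) ∑_{i=1}^{d-1} (q^{12}-1)^{i-1} C(N,i)`,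
i.e. the quantum Gilbert–Varshamov condition fails for alphabet size `q^6`. -/
theorem stmt_17 (q s : ℕ) (hq : 2 ≤ q)
    (hs1 : 7 * q ^ 5 - 14 * q ^ 3 + 7 * q ^ 2 + 12 ≤ s)
    (hs2 : 2 * s ≤ q ^ 7 - q ^ 6 + q ^ 5 + q ^ 4 - 2 * q ^ 3 + q ^ 2 - 2)
    (N d : ℕ) (hN : N = q ^ 8 - q ^ 6 + q ^ 5)
    (hd : d = s - q ^ 5 + 2 * q ^ 3 - q ^ 2 + 2) :
    q ^ (6 * (2 * s - q ^ 5 + 2 * q ^ 3 - q ^ 2 + 4)) - 1 ≤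
      (q ^ 12 - 1) *
        ∑ i ∈ Finset.Icc 1 (d - 1), (q ^ 12 - 1) ^ (i - 1) * N.choose i := by
  have e3 : 4 * q ^ 3 ≤ q ^ 5 := by
    have : 2 ^ 2 ≤ q ^ 2 := Nat.pow_le_pow_left hq 2
    calc 4 * q ^ 3 ≤ q ^ 2 * q ^ 3 := Nat.mul_le_mul_right _ this
      _ = q ^ 5 := by ring
  have e2 : 4 ≤ q ^ 2 := Nat.pow_le_pow_left hq 2
  have e6 : 2 * q ^ 6 ≤ q ^ 7 := by
    calc 2 * q ^ 6 ≤ q * q ^ 6 := Nat.mul_le_mul_right _ hq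
      _ = q ^ 7 := by ring
  have e4 : 2 * q ^ 4 ≤ q ^ 5 := by
    calc 2 * q ^ 4 ≤ q * q ^ 4 := Nat.mul_le_mul_right _ hq
      _ = q ^ 5 := by ring
  have e5 : 2 * q ^ 5 ≤ q ^ 6 := by
    calc 2 * q ^ 5 ≤ q * q ^ 5 := Nat.mul_le_mul_right _ hq
      _ = q ^ 6 := by ring
  have e32 : 2 * q ^ 2 ≤ q ^ 3 := by
    calc 2 * q ^ 2 ≤ q * q ^ 2 := Nat.mul_le_mul_right _ hq
      _ = q ^ 3 := by ring
  have e7 : 2 * q ^ 7 ≤ q ^ 8 := by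
    calc 2 * q ^ 7 ≤ q * q ^ 7 := Nat.mul_le_mul_right _ hq
      _ = q ^ 8 := by ring
  obtain ⟨m, hm⟩ : ∃ m, m = d - 1 := ⟨_, rfl⟩
  have hE : 6 * (2 * s - q ^ 5 + 2 * q ^ 3 - q ^ 2 + 4) ≤ 13 * m := by omega
  have hms : 1 ≤ m ∧ m ≤ s := by omega
  have hmN : 2 * q * m ≤ N := by
    have h1 : 2 * m ≤ q ^ 7 - q ^ 6 + q ^ 5 := by omega
    have h2 : q * (2 * m) ≤ q * (q ^ 7 - q ^ 6 + q ^ 5) := Nat.mul_le_mul_left _ h1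
    have h3 : q * (q ^ 7 - q ^ 6 + q ^ 5) = q ^ 8 - q ^ 7 + q ^ 6 := by
      rw [mul_add, Nat.mul_sub]; ring_nf
    have h4 : 2 * q * m = q * (2 * m) := by ring
    omega
  have hC := aux_choose (2 * q) (by omega) m N hmN
  have hq12 : 2 ≤ q ^ 12 := le_trans (by norm_num) (Nat.pow_le_pow_left hq 12)
  rw [← hm]
  calc q ^ (6 * (2 * s - q ^ 5 + 2 * q ^ 3 - q ^ 2 + 4)) - 1
      ≤ q ^ (13 * m) := (Nat.sub_le _ _).trans (Nat.pow_le_pow_right (by omega) hE)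
    _ = (q ^ 12 * q) ^ m := by rw [pow_mul]; ring
    _ ≤ ((q ^ 12 - 1) * (2 * q)) ^ m := by
        apply Nat.pow_le_pow_left
        rw [← mul_assoc]
        exact Nat.mul_le_mul_right _ (by omega)
    _ = (q ^ 12 - 1) ^ m * (2 * q) ^ m := mul_pow _ _ _
    _ ≤ (q ^ 12 - 1) ^ m * N.choose m := Nat.mul_le_mul_left _ hC
    _ = (q ^ 12 - 1) * ((q ^ 12 - 1) ^ (m - 1) * N.choose m) := by
        rw [← mul_assoc, ← pow_succ', Nat.sub_add_cancel hms.1]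
    _ ≤ _ := by
        apply Nat.mul_le_mul_left
        exact Finset.single_le_sum (f := fun i => (q ^ 12 - 1) ^ (i - 1) * N.choose i)
          (fun i _ => Nat.zero_le _) (Finset.mem_Icc.mpr ⟨hms.1, le_rfl⟩)
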